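/- arXiv:2205.14602 — 2 statements merged into one kernel-verified Lean document; each statement's English description precedes it below -/
import Mathlib

section
/- Let 1 < p < ∞, let T be a monotone quasilinear operator on M⁺(0,∞), let w be a weight on (0,∞), and let v be a weight on (0,∞) such that ∫₀^x v(t)^{1-p'} dt < ∞ for every x ∈ (0,∞). Then there exists a constant C > 0 such that ess sup_{x∈(0,∞)} T(x ↦ ∫₀^x h(t) dt)(x) · w(x) ≤ C ‖h‖_{p,v,(0,∞)} for all h ∈ M⁺(0,∞) if and only if there exists a constant C' > 0 such that ess sup_{x∈(0,∞)} (T(x ↦ (∫₀^x h(t) dt)^{1/p})(x))^p · w(x)^p ≤ C' ‖h‖_{1,Φ^{1-2p},(0,∞)} for all h ∈ M⁺(0,∞), where Φ(x) := (∫₀^x v(t)^{1-p'} dt)^{1/(p'+1)}. -/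
open MeasureTheory Set ENNReal NNReal

noncomputable section

/-- Lebesgue measure restricted to `(0, ∞)`. -/
def mu0 : Measure ℝ := volume.restrict (Ioi (0 : ℝ))

/-- A weight on `(0, ∞)`: a measurable function that is positive (and finite) a.e. on `(0, ∞)`. -/
def IsWeight (v : ℝ → ℝ≥0∞) : Prop :=
  Measurable v ∧ ∀ᵐ x ∂mu0, 0 < v x ∧ v x < ∞

/-- The weighted Lebesgue functional `‖f‖_{p,w,(0,∞)}`. -/
def wnorm (p : ℝ) (w f : ℝ → ℝ≥0∞) : ℝ≥0∞ :=
  (∫⁻ x in Ioi (0 : ℝ), f x ^ p * w x) ^ (1 / p)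

/-- A monotone quasilinear operator on `M⁺(0,∞)`: positively homogeneous, a.e. monotone
(up to a multiplicative constant) and a.e. subadditive (up to a multiplicative constant). -/
structure IsMQL (T : (ℝ → ℝ≥0∞) → ℝ → ℝ≥0∞) : Prop where
  measurable_map : ∀ f : ℝ → ℝ≥0∞, Measurable f → Measurable (T f)
  homog : ∀ (c : ℝ≥0) (f : ℝ → ℝ≥0∞), Measurable f →
    T (fun x => (c : ℝ≥0∞) * f x) = fun x => (c : ℝ≥0∞) * T f x
  mono : ∃ C : ℝ≥0, 0 < C ∧ ∀ f g : ℝ → ℝ≥0∞, Measurable f → Measurable g →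
    (∀ᵐ x ∂mu0, f x ≤ g x) → ∀ᵐ x ∂mu0, T f x ≤ (C : ℝ≥0∞) * T g x
  subadd : ∃ C : ℝ≥0, 0 < C ∧ ∀ f g : ℝ → ℝ≥0∞, Measurable f → Measurable g →
    ∀ᵐ x ∂mu0, T (fun y => f y + g y) x ≤ (C : ℝ≥0∞) * (T f x + T g x)

/-- `Φ(x) = (∫₀^x v(t)^(1-p') dt)^(1/(p'+1))`, where `p' = p/(p-1)`. -/
def Phi (p : ℝ) (v : ℝ → ℝ≥0∞) (x : ℝ) : ℝ≥0∞ :=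
  (∫⁻ t in Ioc (0 : ℝ) x, v t ^ (1 - p / (p - 1))) ^ (1 / (p / (p - 1) + 1))

/-- The primitive `x ↦ ∫₀^x u`. -/
def primitive (u : ℝ → ℝ≥0∞) (x : ℝ) : ℝ≥0∞ := ∫⁻ t in Ioc (0 : ℝ) x, u t

theorem primitive_mono (u : ℝ → ℝ≥0∞) : Monotone (primitive u) := fun _ _ hxy =>
  lintegral_mono_set (Ioc_subset_Ioc_right hxy)

theorem measurable_primitive (u : ℝ → ℝ≥0∞) : Measurable (primitive u) :=
  (primitive_mono u).measurable

theorem primitive_pos {u : ℝ → ℝ≥0∞} (hu : Measurable u) (hpos : ∀ᵐ t ∂mu0, 0 < u t) {x : ℝ}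
    (hx : 0 < x) : 0 < primitive u x := by
  rw [primitive, setLIntegral_pos_iff hu]
  have h : ∀ᵐ t ∂(volume.restrict (Ioc (0 : ℝ) x)), t ∈ Function.support u :=
    (ae_restrict_of_ae_restrict_of_subset Ioc_subset_Ioi_self hpos).mono fun t ht => ht.ne'
  have h2 := measure_eq_measure_of_null_sdiff (μ := volume.restrict (Ioc (0 : ℝ) x))
    (subset_univ (Function.support u)) (by
      rw [← compl_eq_univ_sdiff]; exact h)
  rw [Measure.restrict_apply (measurableSet_support hu), Measure.restrict_apply_univ] at h2
  rw [h2]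
  simpa using hx

theorem continuousOn_toReal_primitive {u : ℝ → ℝ≥0∞} (hu : Measurable u) {x : ℝ}
    (hfin : primitive u x < ∞) : ContinuousOn (fun r => (primitive u r).toReal) (Icc 0 x) := by
  have hint : IntegrableOn (fun t => (u t).toReal) (Icc 0 x) volume := by
    rw [integrableOn_Icc_iff_integrableOn_Ioc]
    exact integrable_toReal_of_lintegral_ne_top hu.aemeasurable hfin.ne
  refine (intervalIntegral.continuousOn_primitive hint).congr fun r hr => ?_
  exact (integral_toReal hu.aemeasurable
    (ae_lt_top hu ((primitive_mono u hr.2).trans_lt hfin).ne)).symm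

/-- The primitive of `u` pushes the measure `u dt` on `(0, x]` forward to Lebesgue measure. -/
theorem map_primitive {u : ℝ → ℝ≥0∞} (hu : Measurable u) {x : ℝ} (hx : 0 < x)
    (hfin : primitive u x < ∞) :
    ((volume.restrict (Ioc (0 : ℝ) x)).withDensity u).map (fun r => (primitive u r).toReal) =
      volume.restrict (Ioc 0 (primitive u x).toReal) := by
  have hmeas : Measurable fun r => (primitive u r).toReal := (measurable_primitive u).ennreal_toReal
  have hmono : ∀ {r s}, s ≤ x → r ≤ s → (primitive u r).toReal ≤ (primitive u s).toReal :=
    fun hs hrs => toReal_mono ((primitive_mono u hs).trans_lt hfin).ne (primitive_mono u hrs)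
  have : IsFiniteMeasure ((volume.restrict (Ioc (0 : ℝ) x)).withDensity u) :=
    isFiniteMeasure_withDensity hfin.ne
  refine Measure.ext_of_Iic _ _ fun c => ?_
  rw [Measure.map_apply hmeas measurableSet_Iic,
    withDensity_apply _ (hmeas measurableSet_Iic),
    Measure.restrict_restrict (hmeas measurableSet_Iic), Measure.restrict_apply measurableSet_Iic]
  rcases lt_or_ge c 0 with hc | hc
  · have h1 : (fun r => (primitive u r).toReal) ⁻¹' Iic c = ∅ := by
      ext r
      simpa using hc.trans_le toReal_nonneg
    have h2 : Iic c ∩ Ioc 0 (primitive u x).toReal = ∅ := by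
      ext s
      simp only [mem_inter_iff, mem_Iic, mem_Ioc, mem_empty_iff_false, iff_false]
      intro h
      linarith [h.1, h.2.1]
    simp [h1, h2]
  rcases le_total (primitive u x).toReal c with hc' | hc'
  · have h1 : (fun r => (primitive u r).toReal) ⁻¹' Iic c ∩ Ioc 0 x = Ioc 0 x :=
      inter_eq_right.2 fun r hr => (hmono le_rfl hr.2).trans hc'
    have h2 : Iic c ∩ Ioc 0 (primitive u x).toReal = Ioc 0 (primitive u x).toReal :=
      inter_eq_right.2 fun r hr => hr.2.trans hc'
    rw [h1, h2, Real.volume_Ioc, sub_zero, ofReal_toReal hfin.ne]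
    rfl
  · have hcont := continuousOn_toReal_primitive hu hfin
    have h0 : (primitive u 0).toReal = 0 := by simp [primitive]
    obtain ⟨m₀, hm₀, hm₀c⟩ := intermediate_value_Icc hx.le hcont (mem_Icc.2 ⟨h0.trans_le hc, hc'⟩)
    have hcomp : IsCompact (Icc 0 x ∩ (fun r => (primitive u r).toReal) ⁻¹' {c}) :=
      isCompact_Icc.of_isClosed_subset (hcont.preimage_isClosed_of_isClosed isClosed_Icc
        isClosed_singleton) inter_subset_left
    obtain ⟨m, ⟨hm, hmc⟩, hmax⟩ := hcomp.exists_isGreatest ⟨m₀, hm₀, hm₀c⟩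
    have hmc : (primitive u m).toReal = c := hmc
    have h1 : (fun r => (primitive u r).toReal) ⁻¹' Iic c ∩ Ioc 0 x = Ioc 0 m := by
      ext r
      constructor
      · rintro ⟨hrc, hr⟩
        refine ⟨hr.1, ?_⟩
        by_contra! hmr
        exact hmr.not_ge (hmax ⟨⟨hr.1.le, hr.2⟩, le_antisymm hrc (hmc ▸ hmono hr.2 hmr.le)⟩)
      · intro hr
        exact ⟨(hmono hm.2 hr.2).trans_eq hmc, hr.1, hr.2.trans hm.2⟩
    have h2 : Iic c ∩ Ioc 0 (primitive u x).toReal = Ioc 0 c := by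
      ext s
      simp only [mem_inter_iff, mem_Iic, mem_Ioc]
      exact ⟨fun h => ⟨h.2.1, h.1⟩, fun h => ⟨h.2, h.1, h.2.trans hc'⟩⟩
    rw [h1, h2, Real.volume_Ioc, sub_zero, ← hmc,
      ofReal_toReal ((primitive_mono u hm.2).trans_lt hfin).ne]
    rfl

/-- Change of variables `s = ∫₀^r u`. -/
theorem lintegral_comp_primitive {u : ℝ → ℝ≥0∞} (hu : Measurable u) {x : ℝ} (hx : 0 < x)
    (hfin : primitive u x < ∞) {φ : ℝ≥0∞ → ℝ≥0∞} (hφ : Measurable φ) :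
    ∫⁻ r in Ioc (0 : ℝ) x, φ (primitive u r) * u r =
      ∫⁻ s in Ioc 0 (primitive u x).toReal, φ (ENNReal.ofReal s) := by
  have hmeas : Measurable fun r => (primitive u r).toReal := (measurable_primitive u).ennreal_toReal
  rw [← map_primitive hu hx hfin, lintegral_map (f := fun s => φ (ENNReal.ofReal s))
    (hφ.comp measurable_ofReal) hmeas,
    lintegral_withDensity_eq_lintegral_mul _ hu
      (g := fun r => φ (ENNReal.ofReal (primitive u r).toReal))
      (hφ.comp (measurable_ofReal.comp hmeas))]
  refine setLIntegral_congr_fun measurableSet_Ioc fun r hr => ?_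
  simp only [Pi.mul_apply]
  rw [ofReal_toReal ((primitive_mono u hr.2).trans_lt hfin).ne, mul_comm]

theorem lintegral_rpow_primitive {u : ℝ → ℝ≥0∞} (hu : Measurable u) {x : ℝ} (hx : 0 < x)
    (hfin : primitive u x < ∞) {q : ℝ} (hq : 0 < q) :
    ENNReal.ofReal q * ∫⁻ r in Ioc (0 : ℝ) x, primitive u r ^ (q - 1) * u r =
      primitive u x ^ q := by
  rw [lintegral_comp_primitive hu hx hfin (φ := fun y => y ^ (q - 1)) (by fun_prop)]
  set K := (primitive u x).toReal with hK
  have hK0 : 0 ≤ K := toReal_nonneg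
  have h1 : ∫⁻ s in Ioc 0 K, ENNReal.ofReal s ^ (q - 1) =
      ∫⁻ s in Ioc 0 K, ENNReal.ofReal (s ^ (q - 1)) :=
    setLIntegral_congr_fun measurableSet_Ioc fun s hs => ofReal_rpow_of_pos hs.1
  have hint : IntegrableOn (fun s : ℝ => s ^ (q - 1)) (Ioc 0 K) volume :=
    (intervalIntegrable_iff_integrableOn_Ioc_of_le hK0).1
      (intervalIntegral.intervalIntegrable_rpow' (by linarith))
  rw [h1, ← ofReal_integral_eq_lintegral_ofReal hint
    ((ae_restrict_mem measurableSet_Ioc).mono fun s hs => Real.rpow_nonneg hs.1.le _),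
    ← intervalIntegral.integral_of_le hK0, integral_rpow (Or.inl (by linarith)), sub_add_cancel,
    Real.zero_rpow hq.ne', sub_zero, ← ofReal_mul hq.le, mul_div_cancel₀ _ hq.ne',
    ← ofReal_rpow_of_nonneg hK0 hq.le, hK, ofReal_toReal hfin.ne]

theorem lintegral_Ici_rpow_primitive_le {u : ℝ → ℝ≥0∞} (hu : Measurable u)
    (hfin : ∀ x, 0 < x → primitive u x < ∞) {t : ℝ} (ht : 0 < t) (hpos : 0 < primitive u t)
    {q : ℝ} (hq : 0 < q) :
    ENNReal.ofReal q * ∫⁻ r in Ici t, primitive u r ^ (-q - 1) * u r ≤ primitive u t ^ (-q) := by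
  set K := (primitive u t).toReal with hK
  have hK0 : 0 < K := toReal_pos hpos.ne' (hfin t ht).ne
  have hIci : (∫⁻ s in Ici K, ENNReal.ofReal s ^ (-q - 1)) =
      ENNReal.ofReal q⁻¹ * primitive u t ^ (-q) := by
    have h1 : ∫⁻ s in Ioi K, ENNReal.ofReal s ^ (-q - 1) =
        ∫⁻ s in Ioi K, ENNReal.ofReal (s ^ (-q - 1)) :=
      setLIntegral_congr_fun measurableSet_Ioi fun s hs => ofReal_rpow_of_pos (hK0.trans hs)
    rw [← restrict_Ioi_eq_restrict_Ici, h1, ← ofReal_integral_eq_lintegral_ofReal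
      (integrableOn_Ioi_rpow_of_lt (by linarith) hK0) ((ae_restrict_mem measurableSet_Ioi).mono
        fun s hs => Real.rpow_nonneg (hK0.trans hs).le _),
      integral_Ioi_rpow_of_lt (by linarith) hK0, sub_add_cancel, neg_div_neg_eq, div_eq_inv_mul,
      ofReal_mul (by positivity), ← ofReal_rpow_of_pos hK0, hK, ofReal_toReal (hfin t ht).ne]
  have hbound : ∀ n : ℕ, ∫⁻ r in Icc t n, primitive u r ^ (-q - 1) * u r ≤
      ENNReal.ofReal q⁻¹ * primitive u t ^ (-q) := by
    intro n
    rcases lt_or_ge (n : ℝ) t with hn | hn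
    · simp [Icc_eq_empty hn.not_ge]
    have hn0 := ht.trans_le hn
    have hφ : Measurable ((Ici (primitive u t)).indicator fun y => y ^ (-q - 1)) :=
      Measurable.indicator (by fun_prop) measurableSet_Ici
    rw [← hIci]
    calc ∫⁻ r in Icc t n, primitive u r ^ (-q - 1) * u r
        = ∫⁻ r in Icc t n,
          (Ici (primitive u t)).indicator (fun y => y ^ (-q - 1)) (primitive u r) * u r :=
          setLIntegral_congr_fun measurableSet_Icc fun r hr => by
            rw [indicator_of_mem (mem_Ici.2 (primitive_mono u hr.1))]
      _ ≤ ∫⁻ r in Ioc (0 : ℝ) n,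
          (Ici (primitive u t)).indicator (fun y => y ^ (-q - 1)) (primitive u r) * u r :=
          lintegral_mono_set fun r hr => ⟨ht.trans_le hr.1, hr.2⟩
      _ = ∫⁻ s in Ioc 0 (primitive u n).toReal,
          (Ici (primitive u t)).indicator (fun y => y ^ (-q - 1)) (ENNReal.ofReal s) :=
          lintegral_comp_primitive hu hn0 (hfin _ hn0) hφ
      _ ≤ ∫⁻ s, (Ici K).indicator (fun s => ENNReal.ofReal s ^ (-q - 1)) s := by
          refine (setLIntegral_le_lintegral _ _).trans (lintegral_mono fun s => ?_)
          by_cases hs : primitive u t ≤ ENNReal.ofReal s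
          · have hKs : K ≤ s := by
              rw [← ofReal_toReal (hfin t ht).ne, ← hK, ofReal_le_ofReal_iff'] at hs
              exact hs.resolve_right hK0.not_ge
            rw [indicator_of_mem (mem_Ici.2 hs), indicator_of_mem (mem_Ici.2 hKs)]
          · rw [indicator_of_notMem (by simpa using hs)]
            exact bot_le
      _ = _ := lintegral_indicator measurableSet_Ici _
  have hU : Ici t = ⋃ n : ℕ, Icc t n := by
    ext r
    simp only [mem_Ici, mem_iUnion, mem_Icc, exists_and_left]
    exact ⟨fun h => ⟨h, exists_nat_ge r⟩, fun h => h.1⟩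
  rw [hU, setLIntegral_iUnion_of_directed]
  · calc _ ≤ ENNReal.ofReal q * (ENNReal.ofReal q⁻¹ * primitive u t ^ (-q)) := by
          gcongr
          exact iSup_le hbound
      _ = _ := by
          rw [← mul_assoc, ← ofReal_mul hq.le, mul_inv_cancel₀ hq.ne', ofReal_one, one_mul]
  · exact Monotone.directed_le fun m n hmn => Icc_subset_Icc_right (by exact_mod_cast hmn)

theorem lintegral_mul_lintegral_Iic (μ : Measure ℝ) [SFinite μ] {a b : ℝ → ℝ≥0∞}
    (ha : Measurable a) (hb : Measurable b) :
    ∫⁻ x, a x * ∫⁻ t in Iic x, b t ∂μ ∂μ = ∫⁻ t, b t * ∫⁻ x in Ici t, a x ∂μ ∂μ := by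
  have hset : MeasurableSet {z : ℝ × ℝ | z.2 ≤ z.1} := measurableSet_le measurable_snd measurable_fst
  have hF : Measurable ({z : ℝ × ℝ | z.2 ≤ z.1}.indicator fun z => a z.1 * b z.2) :=
    Measurable.indicator (by fun_prop) hset
  have h1 : ∀ x, a x * ∫⁻ t in Iic x, b t ∂μ =
      ∫⁻ t, {z : ℝ × ℝ | z.2 ≤ z.1}.indicator (fun z => a z.1 * b z.2) (x, t) ∂μ := fun x => by
    rw [← lintegral_const_mul _ hb, ← lintegral_indicator measurableSet_Iic]
    rfl
  have h2 : ∀ t, b t * ∫⁻ x in Ici t, a x ∂μ =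
      ∫⁻ x, {z : ℝ × ℝ | z.2 ≤ z.1}.indicator (fun z => a z.1 * b z.2) (x, t) ∂μ := fun t => by
    rw [mul_comm, ← lintegral_mul_const _ ha, ← lintegral_indicator measurableSet_Ici]
    rfl
  simp_rw [h1, h2]
  exact lintegral_lintegral_swap hF.aemeasurable

theorem lintegral_Ioi_mul_primitive {a b : ℝ → ℝ≥0∞} (ha : Measurable a) (hb : Measurable b) :
    ∫⁻ x in Ioi (0 : ℝ), a x * primitive b x =
      ∫⁻ t in Ioi (0 : ℝ), b t * ∫⁻ x in Ici t, a x := by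
  have h := lintegral_mul_lintegral_Iic (volume.restrict (Ioi (0 : ℝ))) ha hb
  simp only [Measure.restrict_restrict measurableSet_Iic, Iic_inter_Ioi] at h
  refine h.trans (setLIntegral_congr_fun measurableSet_Ioi fun t ht => ?_)
  rw [Measure.restrict_restrict measurableSet_Ici,
    inter_eq_left.2 ((Ici_subset_Ioi (a := t) (b := 0)).2 ht)]

theorem lintegral_Ioc_mul_primitive {a b : ℝ → ℝ≥0∞} (ha : Measurable a) (hb : Measurable b)
    (x : ℝ) :
    ∫⁻ r in Ioc (0 : ℝ) x, a r * primitive b r =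
      ∫⁻ t in Ioc (0 : ℝ) x, b t * ∫⁻ r in Icc t x, a r := by
  have h := lintegral_mul_lintegral_Iic (volume.restrict (Ioc (0 : ℝ) x)) ha hb
  refine Eq.trans (setLIntegral_congr_fun measurableSet_Ioc fun r hr => ?_)
    (h.trans (setLIntegral_congr_fun measurableSet_Ioc fun t ht => ?_))
  · rw [Measure.restrict_restrict measurableSet_Iic, primitive]
    congr 3
    ext s
    simp only [mem_Ioc, mem_inter_iff, mem_Iic]
    exact ⟨fun h => ⟨h.2, h.1, h.2.trans hr.2⟩, fun h => ⟨h.2.1, h.1⟩⟩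
  · rw [Measure.restrict_restrict measurableSet_Ici]
    congr 3
    ext s
    simp only [mem_Ioc, mem_inter_iff, mem_Ici, mem_Icc]
    exact ⟨fun h => ⟨h.1, h.2.2⟩, fun h => ⟨h.1, ht.1.trans_le h.1, h.2⟩⟩

/-- The weighted tail integral `∫_r^∞ h (∫₀^t u)^(-p) dt`. -/
def weightedTail (p : ℝ) (u h : ℝ → ℝ≥0∞) (r : ℝ) : ℝ≥0∞ :=
  ∫⁻ t in Ici r, h t * primitive u t ^ (-p)

theorem antitone_weightedTail (p : ℝ) (u h : ℝ → ℝ≥0∞) : Antitone (weightedTail p u h) :=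
  fun _ _ hrs => lintegral_mono_set (Ici_subset_Ici.2 hrs)

theorem primitive_le_primitive_weightedTail_rpow {p : ℝ} (hp : 1 < p) {u h : ℝ → ℝ≥0∞}
    (hu : Measurable u) (hh : Measurable h) (hpos : ∀ x, 0 < x → 0 < primitive u x)
    (hfin : ∀ x, 0 < x → primitive u x < ∞) (x : ℝ) :
    primitive h x ≤
      primitive (fun r => (ENNReal.ofReal p * weightedTail p u h r) ^ (1 / p) * u r) x ^ p := by
  have hp0 : 0 < p := by linarith
  have hU := measurable_primitive u
  set g : ℝ → ℝ≥0∞ := fun r => (ENNReal.ofReal p * weightedTail p u h r) ^ (1 / p) with hg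
  have hganti : Antitone g := fun r s hrs => by
    simp only [hg]
    gcongr
    exact antitone_weightedTail p u h hrs
  have hgp : ∀ r, g r ^ p = ENNReal.ofReal p * weightedTail p u h r := fun r => by
    rw [hg, ← ENNReal.rpow_mul, one_div_mul_cancel hp0.ne', ENNReal.rpow_one]
  have hgm : Measurable g := hganti.measurable
  set I := primitive (fun r => g r * u r) x with hI
  have hgU : ∀ r ∈ Ioc 0 x, g r * primitive u r ≤ I := fun r hr => by
    rw [primitive, ← lintegral_const_mul _ hu]
    calc ∫⁻ s in Ioc 0 r, g r * u s ≤ ∫⁻ s in Ioc 0 r, g s * u s :=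
          setLIntegral_mono' measurableSet_Ioc fun s hs => by
            gcongr
            exact hganti hs.2
      _ ≤ I := primitive_mono _ hr.2
  calc primitive h x
      = ∫⁻ t in Ioc 0 x, ENNReal.ofReal p * (h t * primitive u t ^ (-p) *
          primitive (fun r => primitive u r ^ (p - 1) * u r) t) := by
        refine setLIntegral_congr_fun measurableSet_Ioc fun t ht => ?_
        have hpow : ENNReal.ofReal p * primitive (fun r => primitive u r ^ (p - 1) * u r) t =
            primitive u t ^ p := lintegral_rpow_primitive hu ht.1 (hfin t ht.1) hp0
        rw [mul_left_comm, hpow, mul_assoc,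
          ← ENNReal.rpow_add _ _ (hpos t ht.1).ne' (hfin t ht.1).ne, neg_add_cancel,
          ENNReal.rpow_zero, mul_one]
    _ = ENNReal.ofReal p * ∫⁻ r in Ioc 0 x, primitive u r ^ (p - 1) * u r *
          ∫⁻ t in Icc r x, h t * primitive u t ^ (-p) := by
        rw [lintegral_const_mul' _ _ ofReal_ne_top,
          lintegral_Ioc_mul_primitive (by fun_prop) (by fun_prop)]
    _ ≤ ∫⁻ r in Ioc 0 x, I ^ (p - 1) * (g r * u r) := by
        rw [← lintegral_const_mul' _ _ ofReal_ne_top]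
        refine setLIntegral_mono' measurableSet_Ioc fun r hr => ?_
        calc ENNReal.ofReal p * (primitive u r ^ (p - 1) * u r *
              ∫⁻ t in Icc r x, h t * primitive u t ^ (-p))
            ≤ ENNReal.ofReal p * (primitive u r ^ (p - 1) * u r * weightedTail p u h r) := by
              gcongr
              exact lintegral_mono_set Icc_subset_Ici_self
          _ = primitive u r ^ (p - 1) * u r * g r ^ ((p - 1) + 1) := by
              rw [sub_add_cancel, hgp]
              ring
          _ = (g r * primitive u r) ^ (p - 1) * (g r * u r) := by
              rw [ENNReal.rpow_add_of_nonneg _ _ (by linarith) zero_le_one, ENNReal.rpow_one,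
                ENNReal.mul_rpow_of_nonneg _ _ (by linarith)]
              ring
          _ ≤ _ := by
              gcongr
              exact hgU r hr
    _ = I ^ p := by
        rw [lintegral_const_mul _ (by fun_prop)]
        change I ^ (p - 1) * I = I ^ p
        conv_rhs => rw [← sub_add_cancel p 1,
          ENNReal.rpow_add_of_nonneg _ _ (by linarith) zero_le_one, ENNReal.rpow_one]

theorem lintegral_weightedTail_mul {p : ℝ} {u h : ℝ → ℝ≥0∞}
    (hu : Measurable u) (hh : Measurable h) (hpos : ∀ x, 0 < x → 0 < primitive u x)
    (hfin : ∀ x, 0 < x → primitive u x < ∞) :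
    ∫⁻ r in Ioi (0 : ℝ), weightedTail p u h r * u r =
      ∫⁻ t in Ioi (0 : ℝ), h t * primitive u t ^ (1 - p) := by
  have hU := measurable_primitive u
  simp_rw [mul_comm (weightedTail p u h _), weightedTail]
  rw [← lintegral_Ioi_mul_primitive (by fun_prop) hu]
  refine setLIntegral_congr_fun measurableSet_Ioi fun t ht => ?_
  rw [mul_assoc, sub_eq_neg_add, ENNReal.rpow_add _ _ (hpos t ht).ne' (hfin t ht).ne,
    ENNReal.rpow_one]

/-- A density whose primitive dominates `(∫₀^x h)^p` up to a constant. -/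
def powerDensity (p : ℝ) (v u h : ℝ → ℝ≥0∞) (t : ℝ) : ℝ≥0∞ :=
  let q := (p - 1) / p
  let A : ℝ → ℝ≥0∞ := fun t => h t ^ p * v t * primitive u t ^ q
  A t * primitive u t ^ ((p - 1) * q) +
    ENNReal.ofReal ((p - 1) * q) * (primitive u t ^ ((p - 1) * q - 1) * u t * primitive A t)

theorem primitive_mul_rpow_le {u A : ℝ → ℝ≥0∞} (hu : Measurable u) (hA : Measurable A)
    (hfin : ∀ x, 0 < x → primitive u x < ∞) {γ : ℝ} (hγ : 0 < γ) (x : ℝ) :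
    primitive A x * primitive u x ^ γ ≤
      primitive (fun t => A t * primitive u t ^ γ +
        ENNReal.ofReal γ * (primitive u t ^ (γ - 1) * u t * primitive A t)) x := by
  have hU := measurable_primitive u
  have hAm := measurable_primitive A
  calc primitive A x * primitive u x ^ γ
      = ∫⁻ t in Ioc 0 x, A t * primitive u x ^ γ := (lintegral_mul_const _ hA).symm
    _ ≤ ∫⁻ t in Ioc 0 x, (A t * primitive u t ^ γ + ENNReal.ofReal γ *
          (A t * ∫⁻ r in Icc t x, primitive u r ^ (γ - 1) * u r)) := by
        refine setLIntegral_mono' measurableSet_Ioc fun t ht => ?_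
        rw [mul_left_comm, ← mul_add]
        gcongr
        have hx := ht.1.trans_le ht.2
        rw [← lintegral_rpow_primitive hu hx (hfin x hx) hγ,
          ← lintegral_rpow_primitive hu ht.1 (hfin t ht.1) hγ, ← mul_add]
        gcongr
        refine le_trans (lintegral_mono_set fun r hr => ?_) (lintegral_union_le _ _ _)
        exact (le_total r t).imp (fun h => ⟨hr.1, h⟩) fun h => ⟨h, hr.2⟩
    _ = _ := by
        rw [primitive, lintegral_add_left (by fun_prop), lintegral_add_left (by fun_prop),
          lintegral_const_mul' _ _ ofReal_ne_top, lintegral_const_mul' _ _ ofReal_ne_top,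
          lintegral_Ioc_mul_primitive (by fun_prop) hA]

theorem primitive_rpow_le {p : ℝ} (hp : 1 < p) {v h : ℝ → ℝ≥0∞} (hv : IsWeight v)
    (hh : Measurable h)
    (hpos : ∀ x, 0 < x → 0 < primitive (fun t => v t ^ (1 - p / (p - 1))) x)
    (hfin : ∀ x, 0 < x → primitive (fun t => v t ^ (1 - p / (p - 1))) x < ∞) (x : ℝ) :
    primitive h x ^ p ≤ ENNReal.ofReal (p / (p - 1)) ^ (p - 1) *
      primitive (powerDensity p v (fun t => v t ^ (1 - p / (p - 1))) h) x := by
  have hp0 : 0 < p := by linarith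
  have hp1 : 0 < p - 1 := by linarith
  have hvm := hv.1
  set u : ℝ → ℝ≥0∞ := fun t => v t ^ (1 - p / (p - 1)) with hu_def
  have hu : Measurable u := by fun_prop
  have hU := measurable_primitive u
  rcases le_or_gt x 0 with hx | hx
  · simp [primitive, Ioc_eq_empty hx.not_gt, hp0]
  have hconj : p.HolderConjugate (p / (p - 1)) := Real.HolderConjugate.conjExponent hp
  set q := (p - 1) / p with hq
  have hq0 : 0 < q := by positivity
  set A : ℝ → ℝ≥0∞ := fun t => h t ^ p * v t * primitive u t ^ q with hA
  have hAm : Measurable A := by fun_prop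
  have hHolder : primitive h x ≤ primitive A x ^ (1 / p) *
      (ENNReal.ofReal (p / (p - 1)) * primitive u x ^ q) ^ q := by
    calc primitive h x
        = ∫⁻ t in Ioc 0 x, ((fun t => h t * (v t * primitive u t ^ q) ^ (1 / p)) *
            (fun t => (v t * primitive u t ^ q) ^ (-(1 / p)))) t := by
          refine lintegral_congr_ae ?_
          filter_upwards [ae_restrict_mem measurableSet_Ioc,
            ae_restrict_of_ae_restrict_of_subset Ioc_subset_Ioi_self hv.2] with t ht hvt
          have h1 : primitive u t ^ q ≠ 0 := (ENNReal.rpow_pos (hpos t ht.1) (hfin t ht.1).ne).ne'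
          have h2 : primitive u t ^ q ≠ ∞ := ENNReal.rpow_ne_top_of_nonneg hq0.le (hfin t ht.1).ne
          rw [Pi.mul_apply, mul_assoc, ← ENNReal.rpow_add _ _ (mul_ne_zero hvt.1.ne' h1)
            (ENNReal.mul_ne_top hvt.2.ne h2), add_neg_cancel, ENNReal.rpow_zero, mul_one]
      _ ≤ _ := ENNReal.lintegral_mul_le_Lp_mul_Lq _ hconj
          (Measurable.aemeasurable (by fun_prop)) (Measurable.aemeasurable (by fun_prop))
      _ = primitive A x ^ (1 / p) *
          (ENNReal.ofReal (p / (p - 1)) * primitive u x ^ q) ^ q := by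
          congr 1
          · congr 1
            refine lintegral_congr fun t => ?_
            rw [ENNReal.mul_rpow_of_nonneg _ _ hp0.le, ← ENNReal.rpow_mul,
              one_div_mul_cancel hp0.ne', ENNReal.rpow_one, ← mul_assoc]
          · rw [one_div_div]
            congr 1
            rw [← lintegral_rpow_primitive hu hx (hfin x hx) hq0, ← mul_assoc,
              ← ofReal_mul (by positivity), hq, div_mul_div_cancel₀ hp1.ne', div_self hp0.ne',
              ofReal_one, one_mul]
            refine lintegral_congr_ae ?_
            filter_upwards [ae_restrict_mem measurableSet_Ioc,
              ae_restrict_of_ae_restrict_of_subset Ioc_subset_Ioi_self hv.2] with t ht hvt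
            have h1 : primitive u t ^ q ≠ 0 :=
              (ENNReal.rpow_pos (hpos t ht.1) (hfin t ht.1).ne).ne'
            rw [← ENNReal.rpow_mul, ENNReal.mul_rpow_of_ne_zero hvt.1.ne' h1, ← ENNReal.rpow_mul,
              mul_comm]
            congr 2
            · rw [hq]
              field_simp
              ring
            · field_simp
              ring
  have hγ : 0 < (p - 1) * q := by positivity
  calc primitive h x ^ p
      ≤ (primitive A x ^ (1 / p) *
          (ENNReal.ofReal (p / (p - 1)) * primitive u x ^ q) ^ q) ^ p := by gcongr
    _ = ENNReal.ofReal (p / (p - 1)) ^ (p - 1) *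
          (primitive A x * primitive u x ^ ((p - 1) * q)) := by
        have hqp : q * p = p - 1 := div_mul_cancel₀ _ hp0.ne'
        rw [ENNReal.mul_rpow_of_nonneg _ _ hp0.le, ← ENNReal.rpow_mul, ← ENNReal.rpow_mul,
          one_div_mul_cancel hp0.ne', ENNReal.rpow_one, hqp,
          ENNReal.mul_rpow_of_nonneg _ _ hp1.le, ← ENNReal.rpow_mul, mul_comm q]
        ring
    _ ≤ _ := by
        gcongr
        exact primitive_mul_rpow_le hu hAm hfin hγ x

theorem lintegral_powerDensity_mul_le {p : ℝ} (hp : 1 < p) {v u h : ℝ → ℝ≥0∞}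
    (hv : Measurable v) (hu : Measurable u)
    (hh : Measurable h) (hpos : ∀ x, 0 < x → 0 < primitive u x)
    (hfin : ∀ x, 0 < x → primitive u x < ∞) :
    ∫⁻ t in Ioi (0 : ℝ), powerDensity p v u h t * primitive u t ^ (1 - p) ≤
      ENNReal.ofReal p * ∫⁻ t in Ioi (0 : ℝ), h t ^ p * v t := by
  have hp0 : 0 < p := by linarith
  have hp1 : 0 < p - 1 := by linarith
  have hU := measurable_primitive u
  set q := (p - 1) / p with hq
  have hq0 : 0 < q := by positivity
  set A : ℝ → ℝ≥0∞ := fun t => h t ^ p * v t * primitive u t ^ q with hA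
  have hAm : Measurable A := by fun_prop
  have hPA := measurable_primitive A
  have hqp : q * p = p - 1 := div_mul_cancel₀ _ hp0.ne'
  calc ∫⁻ t in Ioi (0 : ℝ), powerDensity p v u h t * primitive u t ^ (1 - p)
      = ∫⁻ t in Ioi (0 : ℝ), (h t ^ p * v t + ENNReal.ofReal ((p - 1) * q) *
          (primitive u t ^ (-q - 1) * u t * primitive A t)) := by
        refine setLIntegral_congr_fun measurableSet_Ioi fun t ht => ?_
        have h0 := (hpos t ht).ne'
        have ht := (hfin t ht).ne
        have e1 : primitive u t ^ q * primitive u t ^ ((p - 1) * q) * primitive u t ^ (1 - p) =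
            1 := by
          rw [← ENNReal.rpow_add _ _ h0 ht, ← ENNReal.rpow_add _ _ h0 ht]
          convert ENNReal.rpow_zero using 2
          linarith
        have e2 : primitive u t ^ ((p - 1) * q - 1) * primitive u t ^ (1 - p) =
            primitive u t ^ (-q - 1) := by
          rw [← ENNReal.rpow_add _ _ h0 ht]
          congr 1
          linarith
        calc _ = h t ^ p * v t * (primitive u t ^ q * primitive u t ^ ((p - 1) * q) *
                primitive u t ^ (1 - p)) + ENNReal.ofReal ((p - 1) * q) *
                ((primitive u t ^ ((p - 1) * q - 1) * primitive u t ^ (1 - p)) * u t *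
                  primitive A t) := by
              simp only [powerDensity, ← hq, ← hA]
              ring
          _ = _ := by rw [e1, e2, mul_one]
    _ = (∫⁻ t in Ioi (0 : ℝ), h t ^ p * v t) + ENNReal.ofReal (p - 1) * (ENNReal.ofReal q *
          ∫⁻ t in Ioi (0 : ℝ), A t * ∫⁻ r in Ici t, primitive u r ^ (-q - 1) * u r) := by
        rw [lintegral_add_left (by fun_prop), lintegral_const_mul' _ _ ofReal_ne_top,
          lintegral_Ioi_mul_primitive (by fun_prop) hAm, ofReal_mul hp1.le, mul_assoc]
    _ ≤ (∫⁻ t in Ioi (0 : ℝ), h t ^ p * v t) + ENNReal.ofReal (p - 1) *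
          ∫⁻ t in Ioi (0 : ℝ), h t ^ p * v t := by
        gcongr
        rw [← lintegral_const_mul' _ _ ofReal_ne_top]
        refine setLIntegral_mono' measurableSet_Ioi fun t ht => ?_
        calc _ = A t * (ENNReal.ofReal q * ∫⁻ r in Ici t, primitive u r ^ (-q - 1) * u r) :=
              mul_left_comm _ _ _
          _ ≤ A t * primitive u t ^ (-q) := by
              gcongr
              exact lintegral_Ici_rpow_primitive_le hu hfin ht (hpos t ht) hq0
          _ = h t ^ p * v t := by
              rw [hA, mul_assoc, ← ENNReal.rpow_add _ _ (hpos t ht).ne' (hfin t ht).ne,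
                add_neg_cancel, ENNReal.rpow_zero, mul_one]
    _ = _ := by
        rw [← one_add_mul, ← ofReal_one, ← ofReal_add zero_le_one hp1.le, add_sub_cancel]

theorem IsWeight.rpow_pos {v : ℝ → ℝ≥0∞} (hv : IsWeight v) (r : ℝ) : ∀ᵐ t ∂mu0, 0 < v t ^ r :=
  hv.2.mono fun _ ht => ENNReal.rpow_pos ht.1 ht.2.ne

theorem IsWeight.rpow_rpow_mul_self {p : ℝ} (hp : 1 < p) {v : ℝ → ℝ≥0∞} (hv : IsWeight v) :
    ∀ᵐ t ∂mu0, (v t ^ (1 - p / (p - 1))) ^ p * v t = v t ^ (1 - p / (p - 1)) := by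
  filter_upwards [hv.2] with t ht
  have hp1 : p - 1 ≠ 0 := by linarith
  conv_lhs => rw [← ENNReal.rpow_mul]; rhs; rw [← ENNReal.rpow_one (v t)]
  rw [← ENNReal.rpow_add _ _ ht.1.ne' ht.2.ne]
  congr 1
  field_simp
  ring

theorem Phi_rpow {p : ℝ} (hp : 1 < p) (v : ℝ → ℝ≥0∞) (t : ℝ) :
    Phi p v t ^ (1 - 2 * p) = primitive (fun t => v t ^ (1 - p / (p - 1))) t ^ (1 - p) := by
  rw [Phi, ← ENNReal.rpow_mul, primitive]
  congr 1
  have h1 : p - 1 ≠ 0 := by linarith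
  have h2 : p + (p - 1) ≠ 0 := by linarith
  field_simp
  ring

theorem wnorm_one_Phi {p : ℝ} (hp : 1 < p) (v h : ℝ → ℝ≥0∞) :
    wnorm 1 (fun t => Phi p v t ^ (1 - 2 * p)) h =
      ∫⁻ t in Ioi (0 : ℝ), h t * primitive (fun t => v t ^ (1 - p / (p - 1))) t ^ (1 - p) := by
  simp only [wnorm, ENNReal.rpow_one, div_one, Phi_rpow hp]

theorem wnorm_rpow {p : ℝ} (hp : 0 < p) (v h : ℝ → ℝ≥0∞) :
    wnorm p v h ^ p = ∫⁻ t in Ioi (0 : ℝ), h t ^ p * v t := by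
  rw [wnorm, ← ENNReal.rpow_mul, one_div_mul_cancel hp.ne', ENNReal.rpow_one]

theorem statement2 (p : ℝ) (hp : 1 < p)
    (T : (ℝ → ℝ≥0∞) → ℝ → ℝ≥0∞) (hT : IsMQL T)
    (w v : ℝ → ℝ≥0∞) (hw : IsWeight w) (hv : IsWeight v)
    (hvfin : ∀ x ∈ Ioi (0 : ℝ), (∫⁻ t in Ioc (0 : ℝ) x, v t ^ (1 - p / (p - 1))) < ∞) :
    (∃ C : ℝ≥0, 0 < C ∧ ∀ h : ℝ → ℝ≥0∞, Measurable h →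
        essSup (fun x => T (fun y => ∫⁻ t in Ioc (0 : ℝ) y, h t) x * w x) mu0 ≤
          (C : ℝ≥0∞) * wnorm p v h) ↔
      (∃ C' : ℝ≥0, 0 < C' ∧ ∀ h : ℝ → ℝ≥0∞, Measurable h →
        essSup (fun x =>
            T (fun y => (∫⁻ t in Ioc (0 : ℝ) y, h t) ^ (1 / p)) x ^ p * w x ^ p) mu0 ≤
          (C' : ℝ≥0∞) * wnorm 1 (fun t => Phi p v t ^ (1 - 2 * p)) h) := by
  have hp0 : 0 < p := by linarith
  have hp1 : 0 < p - 1 := by linarith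
  obtain ⟨D, hD, hmono⟩ := hT.mono
  have hvm := hv.1
  set u : ℝ → ℝ≥0∞ := fun t => v t ^ (1 - p / (p - 1)) with hu_def
  have hu : Measurable u := by fun_prop
  have hpos : ∀ x, 0 < x → 0 < primitive u x := fun x hx =>
    primitive_pos hu (hv.rpow_pos _) hx
  have hfin : ∀ x, 0 < x → primitive u x < ∞ := hvfin
  constructor
  · rintro ⟨C, hC, hbound⟩
    refine ⟨(D * C) ^ p * p.toNNReal, by positivity, fun h hh => ?_⟩
    set g : ℝ → ℝ≥0∞ := fun r => (ENNReal.ofReal p * weightedTail p u h r) ^ (1 / p) * u r with hg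
    have hgm : Measurable g := by
      have := (antitone_weightedTail p u h).measurable
      fun_prop
    have hHg : ∀ x, primitive h x ^ (1 / p) ≤ primitive g x := fun x => by
      rw [one_div, ENNReal.rpow_inv_le_iff hp0]
      exact primitive_le_primitive_weightedTail_rpow hp hu hh hpos hfin x
    have hcost : wnorm p v g ^ p =
        ENNReal.ofReal p * wnorm 1 (fun t => Phi p v t ^ (1 - 2 * p)) h := by
      rw [wnorm_one_Phi hp, ← lintegral_weightedTail_mul hu hh hpos hfin, wnorm_rpow hp0,
        ← lintegral_const_mul' _ _ ofReal_ne_top]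
      refine lintegral_congr_ae ((hv.rpow_rpow_mul_self hp).mono fun t ht => ?_)
      simp only [hg]
      rw [ENNReal.mul_rpow_of_nonneg _ _ hp0.le, ← ENNReal.rpow_mul, one_div_mul_cancel hp0.ne',
        ENNReal.rpow_one, mul_assoc, ht, mul_assoc]
    refine essSup_le_of_ae_le _ ?_
    filter_upwards [hmono (fun x => primitive h x ^ (1 / p)) (primitive g)
      ((measurable_primitive h).pow_const _) (measurable_primitive g) (ae_of_all _ hHg),
      ENNReal.ae_le_essSup (μ := mu0) fun x => T (primitive g) x * w x] with x hx1 hx2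
    calc T (fun x => primitive h x ^ (1 / p)) x ^ p * w x ^ p
        = (T (fun x => primitive h x ^ (1 / p)) x * w x) ^ p :=
          (ENNReal.mul_rpow_of_nonneg _ _ hp0.le).symm
      _ ≤ (D * T (primitive g) x * w x) ^ p := by gcongr
      _ = (D * (T (primitive g) x * w x)) ^ p := by rw [mul_assoc]
      _ ≤ (D * (C * wnorm p v g)) ^ p := by
          have := hx2.trans (hbound g hgm)
          exact ENNReal.rpow_le_rpow (mul_le_mul_right this _) hp0.le
      _ = _ := by
          rw [← mul_assoc, ENNReal.mul_rpow_of_nonneg _ _ hp0.le, hcost, ← mul_assoc,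
            ENNReal.coe_mul, ENNReal.coe_rpow_of_nonneg _ hp0.le, ENNReal.coe_mul]
          rfl
  · rintro ⟨C, hC, hbound⟩
    set κ : ℝ≥0 := (p / (p - 1)).toNNReal ^ (p - 1) with hκ
    have hκ' : (κ : ℝ≥0∞) = ENNReal.ofReal (p / (p - 1)) ^ (p - 1) :=
      ENNReal.coe_rpow_of_nonneg _ hp1.le
    have hκ0 : 0 < κ := NNReal.rpow_pos (Real.toNNReal_pos.2 (by positivity))
    clear_value κ
    refine ⟨D * (C * (κ * p.toNNReal)) ^ (1 / p),
      mul_pos hD (NNReal.rpow_pos (by positivity)), fun h hh => ?_⟩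
    have hpd : Measurable (powerDensity p v u h) := by
      have := measurable_primitive u
      have := measurable_primitive fun t => h t ^ p * v t * primitive u t ^ ((p - 1) / p)
      unfold powerDensity
      fun_prop
    set g : ℝ → ℝ≥0∞ := fun t => κ * powerDensity p v u h t with hg
    have hgm : Measurable g := by fun_prop
    have hHg : ∀ x, primitive h x ≤ primitive g x ^ (1 / p) := fun x => by
      rw [one_div, ENNReal.le_rpow_inv_iff hp0]
      refine (primitive_rpow_le hp hv hh hpos hfin x).trans_eq ?_
      rw [← hκ', primitive, ← lintegral_const_mul _ hpd, primitive]
    have hcost : wnorm 1 (fun t => Phi p v t ^ (1 - 2 * p)) g ≤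
        κ * (ENNReal.ofReal p * wnorm p v h ^ p) := by
      rw [wnorm_one_Phi hp, wnorm_rpow hp0]
      simp only [hg, mul_assoc]
      rw [lintegral_const_mul' _ _ coe_ne_top]
      gcongr
      exact lintegral_powerDensity_mul_le hp hvm hu hh hpos hfin
    refine essSup_le_of_ae_le _ ?_
    filter_upwards [hmono (primitive h) (fun x => primitive g x ^ (1 / p))
      (measurable_primitive h) ((measurable_primitive g).pow_const _) (ae_of_all _ hHg),
      ENNReal.ae_le_essSup (μ := mu0)
        fun x => T (fun x => primitive g x ^ (1 / p)) x ^ p * w x ^ p] with x hx1 hx2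
    calc T (primitive h) x * w x
        ≤ D * T (fun x => primitive g x ^ (1 / p)) x * w x := by gcongr
      _ = D * (T (fun x => primitive g x ^ (1 / p)) x ^ p * w x ^ p) ^ (1 / p) := by
          rw [← ENNReal.mul_rpow_of_nonneg _ _ hp0.le, ← ENNReal.rpow_mul,
            mul_one_div_cancel hp0.ne', ENNReal.rpow_one, mul_assoc]
      _ ≤ D * (C * (κ * (ENNReal.ofReal p * wnorm p v h ^ p))) ^ (1 / p) := by
          have := (hx2.trans (hbound g hgm)).trans (mul_le_mul_right hcost _)
          exact mul_le_mul_right (ENNReal.rpow_le_rpow this (by positivity)) _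
      _ = D * ((C * (κ * ENNReal.ofReal p)) * wnorm p v h ^ p) ^ (1 / p) := by
          simp only [mul_assoc]
      _ = _ := by
          rw [ENNReal.mul_rpow_of_nonneg _ _ (by positivity), ← ENNReal.rpow_mul,
            mul_one_div_cancel hp0.ne', ENNReal.rpow_one, ← mul_assoc, ENNReal.coe_mul,
            ENNReal.coe_rpow_of_nonneg _ (by positivity), ENNReal.coe_mul, ENNReal.coe_mul]
          rfl
end
end

section
/- Let 1 < p < ∞, let T be a monotone quasilinear operator on M⁺(0,∞), let w be a weight on (0,∞), and let v be a weight on (0,∞) such that ∫_x^∞ v(t)^{1-p'} dt < ∞ for every x ∈ (0,∞). Then there exists a constant C > 0 such that ess sup_{x∈(0,∞)} T(x ↦ ∫_x^∞ h(t) dt)(x) · w(x) ≤ C ‖h‖_{p,v,(0,∞)} for all h ∈ M⁺(0,∞) if and only if there exists a constant C' > 0 such that ess sup_{x∈(0,∞)} (T(x ↦ (∫_x^∞ h(t) dt)^{1/p})(x))^p · w(x)^p ≤ C' ‖h‖_{1,Ψ^{1-2p},(0,∞)} for all h ∈ M⁺(0,∞), where Ψ(x) := (∫_x^∞ v(t)^{1-p'}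 dt)^{1/(p'+1)}. -/
open MeasureTheory Set ENNReal NNReal

noncomputable section

/-- `Ψ(x) = (∫_x^∞ v(t)^(1-p') dt)^(1/(p'+1))`, where `p' = p/(p-1)`. -/
def Psi (p : ℝ) (v : ℝ → ℝ≥0∞) (x : ℝ) : ℝ≥0∞ :=
  (∫⁻ t in Ioi x, v t ^ (1 - p / (p - 1))) ^ (1 / (p / (p - 1) + 1))

/-- The tail integral `∫_x^∞ f`. -/
def tailIntegral (f : ℝ → ℝ≥0∞) (x : ℝ) : ℝ≥0∞ := ∫⁻ t in Ioi x, f t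

theorem tailIntegral_antitone (f : ℝ → ℝ≥0∞) : Antitone (tailIntegral f) :=
  fun _ _ hxy => lintegral_mono_set (Ioi_subset_Ioi hxy)

theorem measurable_tailIntegral (f : ℝ → ℝ≥0∞) : Measurable (tailIntegral f) :=
  (tailIntegral_antitone f).measurable

/-- Tonelli's theorem on the triangle `x < t < s`. -/
theorem lintegral_tailIntegral_mul {a b : ℝ → ℝ≥0∞} (ha : Measurable a) (hb : Measurable b)
    (x : ℝ) :
    ∫⁻ t in Ioi x, a t * tailIntegral b t = ∫⁻ s in Ioi x, b s * ∫⁻ t in Ioo x s, a t := by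
  have h1 : ∀ t, tailIntegral b t = ∫⁻ s, (Ioi t).indicator b s := fun t =>
    (lintegral_indicator measurableSet_Ioi _).symm
  have h2 : ∀ s ∈ Ioi x, ∫⁻ t in Ioo x s, a t = ∫⁻ t in Ioi x, (Iio s).indicator a t := by
    intro s _
    rw [lintegral_indicator measurableSet_Iio, Measure.restrict_restrict measurableSet_Iio,
      Iio_inter_Ioi]
  have hm : Measurable (fun z : ℝ × ℝ => {z : ℝ × ℝ | z.1 < z.2}.indicator
      (fun z => a z.1 * b z.2) z) :=
    (by fun_prop : Measurable fun z : ℝ × ℝ => a z.1 * b z.2).indicator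
      (measurableSet_lt measurable_fst measurable_snd)
  have h3 : ∀ t ∈ Ioi x, a t * tailIntegral b t =
      ∫⁻ s in Ioi x, {z : ℝ × ℝ | z.1 < z.2}.indicator (fun z => a z.1 * b z.2) (t, s) := by
    intro t ht
    rw [h1, ← lintegral_const_mul _ (hb.indicator measurableSet_Ioi),
      ← lintegral_indicator measurableSet_Ioi]
    refine lintegral_congr fun s => ?_
    by_cases hts : t < s
    · have : x < s := lt_trans ht hts
      simp [indicator, hts, this]
    · simp [indicator, hts]
  have h4 : ∀ s ∈ Ioi x, b s * ∫⁻ t in Ioo x s, a t =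
      ∫⁻ t in Ioi x, {z : ℝ × ℝ | z.1 < z.2}.indicator (fun z => a z.1 * b z.2) (t, s) := by
    intro s hs
    rw [h2 s hs, ← lintegral_const_mul _ (ha.indicator measurableSet_Iio)]
    refine lintegral_congr fun t => ?_
    by_cases hts : t < s
    · simp [indicator, hts, mul_comm]
    · simp [indicator, hts]
  rw [setLIntegral_congr_fun measurableSet_Ioi h3, setLIntegral_congr_fun measurableSet_Ioi h4]
  exact lintegral_lintegral_swap hm.aemeasurable

/-- The sublevel sets of a tail integral are small for the measure that defines it. -/
theorem withDensity_tailIntegral_lt_le (f : ℝ → ℝ≥0∞) (u : ℝ≥0∞) :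
    volume.withDensity f {t | tailIntegral f t < u} ≤ u := by
  set A := {t | tailIntegral f t < u} with hA
  have hup : ∀ {a b : ℝ}, a ∈ A → a ≤ b → b ∈ A := fun ha hab =>
    lt_of_le_of_lt (tailIntegral_antitone f hab) ha
  set B : Set ℝ := ⋃ q : {q : ℚ // (q : ℝ) ∈ A}, Ioi ((q : ℚ) : ℝ) with hB
  have hsub : (A \ B).Subsingleton := by
    have key : ∀ a ∈ A \ B, ∀ b ∈ A \ B, ¬ a < b := by
      intro a ha b hb hab
      obtain ⟨q, haq, hqb⟩ := exists_rat_btwn hab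
      exact hb.2 (mem_iUnion.2 ⟨⟨q, hup ha.1 haq.le⟩, hqb⟩)
    intro a ha b hb
    exact le_antisymm (not_lt.1 (key b hb a ha)) (not_lt.1 (key a ha b hb))
  have hnull : volume.withDensity f (A \ B) = 0 :=
    withDensity_absolutelyContinuous _ _ (hsub.measure_zero volume)
  have hBle : volume.withDensity f B ≤ u := by
    have hdir : Directed (· ⊆ ·) fun q : {q : ℚ // (q : ℝ) ∈ A} => Ioi ((q : ℚ) : ℝ) := by
      intro q r
      rcases le_total (q : ℚ) (r : ℚ) with h | h
      · exact ⟨q, subset_rfl, Ioi_subset_Ioi (by exact_mod_cast h)⟩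
      · exact ⟨r, Ioi_subset_Ioi (by exact_mod_cast h), subset_rfl⟩
    rw [hB, hdir.measure_iUnion]
    refine iSup_le fun q => ?_
    rw [withDensity_apply _ measurableSet_Ioi]
    exact q.2.le
  calc volume.withDensity f A ≤ volume.withDensity f (B ∪ A \ B) :=
        measure_mono (by rw [union_sdiff_self]; exact subset_union_right)
    _ ≤ volume.withDensity f B + volume.withDensity f (A \ B) := measure_union_le _ _
    _ ≤ u := by rw [hnull, add_zero]; exact hBle

theorem lintegral_Ioc_ofReal_rpow {a b : ℝ} (ha : 0 < a) (hb : 0 < b) :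
    ∫⁻ y in Ioc 0 b, ENNReal.ofReal (y ^ (a - 1)) = ENNReal.ofReal (b ^ a / a) := by
  have hint : IntervalIntegrable (fun y : ℝ => y ^ (a - 1)) volume 0 b :=
    intervalIntegral.intervalIntegrable_rpow' (by linarith)
  rw [← ofReal_integral_eq_lintegral_ofReal
    ((intervalIntegrable_iff_integrableOn_Ioc_of_le hb.le).1 hint)
    ((ae_restrict_iff' measurableSet_Ioc).2
      (ae_of_all _ fun y hy => Real.rpow_nonneg hy.1.le _)),
    ← intervalIntegral.integral_of_le hb.le, integral_rpow (Or.inl (by linarith))]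
  simp [Real.zero_rpow ha.ne']

theorem lintegral_Ioi_ofReal_rpow {a b : ℝ} (ha : 0 < a) (hb : 0 < b) :
    ∫⁻ y in Ioi b, ENNReal.ofReal (y ^ (-a - 1)) = ENNReal.ofReal (b ^ (-a) / a) := by
  rw [← ofReal_integral_eq_lintegral_ofReal (integrableOn_Ioi_rpow_of_lt (by linarith) hb)
    ((ae_restrict_iff' measurableSet_Ioi).2
      (ae_of_all _ fun y hy => Real.rpow_nonneg (hb.trans hy).le _)),
    integral_Ioi_rpow_of_lt (by linarith) hb]
  simp [neg_div_neg_eq]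

/-- Layer-cake formula for negative powers of a tail integral. -/
theorem setLIntegral_mul_tailIntegral_rpow_neg {f : ℝ → ℝ≥0∞} (hf : Measurable f)
    {S : Set ℝ} (hS : MeasurableSet S)
    (hS0 : ∀ t ∈ S, tailIntegral f t ≠ 0) (hStop : ∀ t ∈ S, tailIntegral f t ≠ ∞)
    {q : ℝ} (hq : 0 < q) :
    ∫⁻ t in S, f t * tailIntegral f t ^ (-q) =
      ENNReal.ofReal q * ∫⁻ y in Ioi (0 : ℝ),
        volume.withDensity f ({t | tailIntegral f t < ENNReal.ofReal y⁻¹} ∩ S) *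
          ENNReal.ofReal (y ^ (q - 1)) := by
  have hV := measurable_tailIntegral f
  have h1 : ∫⁻ t in S, f t * tailIntegral f t ^ (-q) =
      ∫⁻ t in S, ENNReal.ofReal ((tailIntegral f t).toReal⁻¹ ^ q) ∂volume.withDensity f := by
    rw [setLIntegral_withDensity_eq_setLIntegral_mul _ hf (by fun_prop) hS]
    refine setLIntegral_congr_fun hS fun t ht => ?_
    have hpos := ENNReal.toReal_pos (hS0 t ht) (hStop t ht)
    simp only [Pi.mul_apply]
    rw [← ENNReal.ofReal_rpow_of_pos (inv_pos.2 hpos), ENNReal.ofReal_inv_of_pos hpos,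
      ENNReal.ofReal_toReal (hStop t ht), ENNReal.inv_rpow, ENNReal.rpow_neg]
  rw [h1, lintegral_rpow_eq_lintegral_meas_lt_mul _
    (ae_of_all _ fun t => inv_nonneg.2 ENNReal.toReal_nonneg) (by fun_prop) hq]
  congr 1
  refine setLIntegral_congr_fun measurableSet_Ioi fun y hy => ?_
  have hm : MeasurableSet {t | y < (tailIntegral f t).toReal⁻¹} :=
    measurableSet_lt measurable_const (by fun_prop)
  rw [Measure.restrict_apply hm]
  congr 2
  ext t
  simp only [mem_inter_iff, mem_ofPred_eq, and_congr_left_iff]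
  intro ht
  have hpos := ENNReal.toReal_pos (hS0 t ht) (hStop t ht)
  rw [ENNReal.lt_ofReal_iff_toReal_lt (hStop t ht), lt_inv_comm₀ hy hpos]

theorem setLIntegral_Ioi_mul_tailIntegral_rpow_neg_le {f : ℝ → ℝ≥0∞} (hf : Measurable f) {x : ℝ}
    (h0 : ∀ t, x ≤ t → tailIntegral f t ≠ 0) (htop : ∀ t, x ≤ t → tailIntegral f t ≠ ∞)
    {θ : ℝ} (hθ : 0 < θ) (hθ1 : θ < 1) :
    ∫⁻ t in Ioi x, f t * tailIntegral f t ^ (-θ) ≤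
      ENNReal.ofReal (1 / (1 - θ)) * tailIntegral f x ^ (1 - θ) := by
  rw [setLIntegral_mul_tailIntegral_rpow_neg hf measurableSet_Ioi
    (fun t ht => h0 t (le_of_lt ht)) (fun t ht => htop t (le_of_lt ht)) hθ]
  set c := (tailIntegral f x).toReal with hc
  have hcpos : 0 < c := ENNReal.toReal_pos (h0 x le_rfl) (htop x le_rfl)
  have hVx : tailIntegral f x = ENNReal.ofReal c := (ENNReal.ofReal_toReal (htop x le_rfl)).symm
  have hb : 0 < c⁻¹ := inv_pos.2 hcpos
  have hlow : ∫⁻ y in Ioc 0 c⁻¹,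
      volume.withDensity f ({t | tailIntegral f t < ENNReal.ofReal y⁻¹} ∩ Ioi x) *
          ENNReal.ofReal (y ^ (θ - 1)) ≤ ENNReal.ofReal c * ENNReal.ofReal (c⁻¹ ^ θ / θ) := by
    rw [← lintegral_Ioc_ofReal_rpow hθ hb, ← lintegral_const_mul _ (by fun_prop)]
    refine lintegral_mono fun y => ?_
    gcongr
    refine (measure_mono inter_subset_right).trans ?_
    rw [withDensity_apply _ measurableSet_Ioi, ← hVx]
    rfl
  have hhigh : ∫⁻ y in Ioi c⁻¹,
      volume.withDensity f ({t | tailIntegral f t < ENNReal.ofReal y⁻¹} ∩ Ioi x) *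
          ENNReal.ofReal (y ^ (θ - 1)) ≤ ENNReal.ofReal (c⁻¹ ^ (-(1 - θ)) / (1 - θ)) := by
    rw [← lintegral_Ioi_ofReal_rpow (sub_pos.2 hθ1) hb]
    refine setLIntegral_mono (by fun_prop) fun y hy => ?_
    have hy0 : 0 < y := hb.trans hy
    have hpow : y ^ (-(1 - θ) - 1) = y⁻¹ * y ^ (θ - 1) := by
      rw [← Real.rpow_neg_one, ← Real.rpow_add hy0]
      congr 1
      ring
    rw [hpow, ENNReal.ofReal_mul (inv_pos.2 hy0).le]
    gcongr
    exact (measure_mono inter_subset_left).trans (withDensity_tailIntegral_lt_le f _)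
  rw [← Ioc_union_Ioi_eq_Ioi hb.le, lintegral_union measurableSet_Ioi (Ioc_disjoint_Ioi le_rfl)]
  calc _ ≤ ENNReal.ofReal θ * (ENNReal.ofReal c * ENNReal.ofReal (c⁻¹ ^ θ / θ) +
        ENNReal.ofReal (c⁻¹ ^ (-(1 - θ)) / (1 - θ))) := by gcongr
    _ = ENNReal.ofReal (θ * (c * (c⁻¹ ^ θ / θ) + c⁻¹ ^ (-(1 - θ)) / (1 - θ))) := by
        have : 0 < 1 - θ := sub_pos.2 hθ1
        rw [ENNReal.ofReal_mul hθ.le, ENNReal.ofReal_add (by positivity) (by positivity),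
          ENNReal.ofReal_mul hcpos.le]
    _ = ENNReal.ofReal (1 / (1 - θ) * c ^ (1 - θ)) := by
        have h1 : (1 - θ) ≠ 0 := (sub_pos.2 hθ1).ne'
        have e1 : c⁻¹ ^ (-(1 - θ)) = c ^ (1 - θ) := by
          rw [Real.inv_rpow hcpos.le, Real.rpow_neg hcpos.le, inv_inv]
        have e2 : c * c⁻¹ ^ θ = c ^ (1 - θ) := by
          rw [Real.inv_rpow hcpos.le, Real.rpow_sub hcpos, Real.rpow_one]
          rfl
        rw [e1, ← mul_div_assoc, e2]
        congr 1
        field_simp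
        ring
    _ = _ := by
        rw [ENNReal.ofReal_mul (by have := sub_pos.2 hθ1; positivity), hVx,
          ENNReal.ofReal_rpow_of_pos hcpos]

theorem setLIntegral_Ioo_mul_tailIntegral_rpow_neg_le {f : ℝ → ℝ≥0∞} (hf : Measurable f)
    {x s : ℝ} (h0 : ∀ t, x < t → tailIntegral f t ≠ 0) (htop : ∀ t, x < t → tailIntegral f t ≠ ∞)
    (hxs : x < s) {r : ℝ} (hr : 0 < r) :
    ∫⁻ t in Ioo x s, f t * tailIntegral f t ^ (-(1 + r)) ≤
      ENNReal.ofReal ((1 + r) / r) * tailIntegral f s ^ (-r) := by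
  rw [setLIntegral_mul_tailIntegral_rpow_neg hf measurableSet_Ioo
    (fun t ht => h0 t ht.1) (fun t ht => htop t ht.1) (by linarith)]
  set c := (tailIntegral f s).toReal with hc
  have hcpos : 0 < c := ENNReal.toReal_pos (h0 s hxs) (htop s hxs)
  have hVs : tailIntegral f s = ENNReal.ofReal c := (ENNReal.ofReal_toReal (htop s hxs)).symm
  have hb : 0 < c⁻¹ := inv_pos.2 hcpos
  have hlow : ∫⁻ y in Ioc 0 c⁻¹,
      volume.withDensity f ({t | tailIntegral f t < ENNReal.ofReal y⁻¹} ∩ Ioo x s) *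
          ENNReal.ofReal (y ^ (1 + r - 1)) ≤ ENNReal.ofReal (c⁻¹ ^ r / r) := by
    rw [← lintegral_Ioc_ofReal_rpow hr hb]
    refine setLIntegral_mono (by fun_prop) fun y hy => ?_
    have hpow : y ^ (r - 1) = y⁻¹ * y ^ (1 + r - 1) := by
      rw [← Real.rpow_neg_one, ← Real.rpow_add hy.1]
      congr 1
      ring
    rw [hpow, ENNReal.ofReal_mul (inv_pos.2 hy.1).le]
    gcongr
    exact (measure_mono inter_subset_left).trans (withDensity_tailIntegral_lt_le f _)
  have hhigh : ∫⁻ y in Ioi c⁻¹,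
      volume.withDensity f ({t | tailIntegral f t < ENNReal.ofReal y⁻¹} ∩ Ioo x s) *
          ENNReal.ofReal (y ^ (1 + r - 1)) = 0 := by
    refine setLIntegral_eq_zero measurableSet_Ioi fun y hy => ?_
    have hempty : {t | tailIntegral f t < ENNReal.ofReal y⁻¹} ∩ Ioo x s = ∅ := by
      rw [eq_empty_iff_forall_notMem]
      rintro t ⟨ht, -, hts⟩
      have hlt := (tailIntegral_antitone f hts.le).trans_lt ht
      rw [hVs, ENNReal.ofReal_lt_ofReal_iff (inv_pos.2 (hb.trans hy)),
        lt_inv_comm₀ hcpos (hb.trans hy)] at hlt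
      exact lt_asymm hlt hy
    simp [hempty]
  rw [← Ioc_union_Ioi_eq_Ioi hb.le, lintegral_union measurableSet_Ioi (Ioc_disjoint_Ioi le_rfl),
    hhigh, add_zero]
  calc _ ≤ ENNReal.ofReal (1 + r) * ENNReal.ofReal (c⁻¹ ^ r / r) := by gcongr
    _ = ENNReal.ofReal ((1 + r) / r * c ^ (-r)) := by
        rw [← ENNReal.ofReal_mul (by linarith), Real.inv_rpow hcpos.le, Real.rpow_neg hcpos.le]
        congr 1
        ring
    _ = _ := by
        rw [ENNReal.ofReal_mul (by positivity), hVs, ENNReal.ofReal_rpow_of_pos hcpos]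

theorem measurable_lintegral_Ioo_left (f : ℝ → ℝ≥0∞) (a : ℝ) :
    Measurable fun t => ∫⁻ s in Ioo a t, f s :=
  Monotone.measurable fun _ _ h => lintegral_mono_set (Ioo_subset_Ioo_right h)

theorem tailIntegral_rpow_one_div_le {p q : ℝ} (hpq : p.HolderConjugate q) {f g : ℝ → ℝ≥0∞}
    (hf : Measurable f) (hg : Measurable g) (h0 : ∀ t, 0 < t → tailIntegral f t ≠ 0)
    (htop : ∀ t, 0 < t → tailIntegral f t ≠ ∞)
    (hfin : ∫⁻ t in Ioi (0 : ℝ), g t * tailIntegral f t ^ (1 - p) ≠ ∞) {x : ℝ} (hx : 0 < x) :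
    tailIntegral g x ^ (1 / p) ≤ tailIntegral
      (fun t => f t * (∫⁻ s in Ioo 0 t, g s * tailIntegral f s ^ (-p)) ^ (1 / p)) x := by
  have hp := hpq.lt
  have hp0 := hpq.pos
  have hV := measurable_tailIntegral f
  set G := tailIntegral g x with hG
  have hGtop : G ≠ ∞ := by
    have h1 : G ≤ tailIntegral f x ^ (p - 1) *
        ∫⁻ t in Ioi (0 : ℝ), g t * tailIntegral f t ^ (1 - p) := by
      rw [← lintegral_const_mul _ (by fun_prop)]
      refine le_trans ?_ (lintegral_mono_set (Ioi_subset_Ioi hx.le))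
      refine setLIntegral_mono (by fun_prop) fun t ht => ?_
      have ht0 : 0 < t := hx.trans ht
      calc g t = tailIntegral f t ^ (p - 1) * (g t * tailIntegral f t ^ (1 - p)) := by
            rw [mul_left_comm, ← ENNReal.rpow_add _ _ (h0 t ht0) (htop t ht0)]
            simp
        _ ≤ _ := by
            gcongr
            exact tailIntegral_antitone f (le_of_lt ht)
    refine ne_top_of_le_ne_top (ENNReal.mul_ne_top ?_ hfin) h1
    exact ENNReal.rpow_ne_top_of_nonneg (by linarith) (htop x hx)
  by_cases hG0 : G = 0
  · rw [hG0, ENNReal.zero_rpow_of_pos (by positivity)]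
    exact zero_le
  have hmain : G ≤ G ^ (1 / q) * tailIntegral
      (fun t => f t * (∫⁻ s in Ioo 0 t, g s * tailIntegral f s ^ (-p)) ^ (1 / p)) x := by
    have hm := measurable_lintegral_Ioo_left (fun s => g s * tailIntegral f s ^ (-p)) 0
    calc G = ∫⁻ s in Ioi x, (g s * tailIntegral f s ^ (-1 : ℝ)) * tailIntegral f s := by
          refine setLIntegral_congr_fun measurableSet_Ioi fun s hs => ?_
          have hs0 : 0 < s := hx.trans hs
          rw [ENNReal.rpow_neg_one, mul_assoc, ENNReal.inv_mul_cancel (h0 s hs0) (htop s hs0),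
            mul_one]
      _ = ∫⁻ t in Ioi x, f t * ∫⁻ s in Ioo x t, g s * tailIntegral f s ^ (-1 : ℝ) :=
          lintegral_tailIntegral_mul (by fun_prop) hf x
      _ ≤ ∫⁻ t in Ioi x, G ^ (1 / q) *
            (f t * (∫⁻ s in Ioo 0 t, g s * tailIntegral f s ^ (-p)) ^ (1 / p)) := by
          refine setLIntegral_mono (by fun_prop) fun t ht => ?_
          rw [mul_left_comm]
          gcongr
          have hH := ENNReal.lintegral_mul_le_Lp_mul_Lq (volume.restrict (Ioo x t)) hpq
            (f := fun s => (g s * tailIntegral f s ^ (-p)) ^ (1 / p))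
            (g := fun s => g s ^ (1 / q)) (by fun_prop) (by fun_prop)
          simp only [← ENNReal.rpow_mul, one_div_mul_cancel hpq.ne_zero,
            one_div_mul_cancel hpq.symm.ne_zero, ENNReal.rpow_one] at hH
          calc _ = ∫⁻ s in Ioo x t, ((fun s => (g s * tailIntegral f s ^ (-p)) ^ (1 / p)) *
                  (fun s => g s ^ (1 / q))) s := by
                refine lintegral_congr fun s => ?_
                simp only [Pi.mul_apply]
                rw [ENNReal.mul_rpow_of_nonneg _ _ (by positivity), ← ENNReal.rpow_mul,
                  mul_right_comm, ← ENNReal.rpow_add_of_nonneg _ _ (by positivity)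
                  (one_div_nonneg.2 hpq.symm.nonneg), one_div, one_div, hpq.inv_add_inv_eq_one,
                  ENNReal.rpow_one, neg_mul, mul_inv_cancel₀ hpq.ne_zero]
            _ ≤ _ := hH
            _ ≤ _ := by
                rw [mul_comm]
                have := hpq.symm.nonneg
                gcongr
                exact lintegral_mono_set Ioo_subset_Ioi_self
      _ = _ := lintegral_const_mul _ (by fun_prop)
  have hsplit : G = G ^ (1 / q) * G ^ (1 / p) := by
    rw [← ENNReal.rpow_add _ _ hG0 hGtop, one_div, one_div, hpq.symm.inv_add_inv_eq_one,
      ENNReal.rpow_one]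
  have hq0 : G ^ (1 / q) ≠ 0 := by simp [ENNReal.rpow_eq_zero_iff, hG0, hGtop]
  have hqtop : G ^ (1 / q) ≠ ∞ := by simp [ENNReal.rpow_eq_top_iff, hG0, hGtop]
  exact (ENNReal.mul_le_mul_iff_right hq0 hqtop).1 (hsplit ▸ hmain)

theorem lintegral_mul_lintegral_Ioo_rpow_neg {p : ℝ} {f g : ℝ → ℝ≥0∞} (hf : Measurable f)
    (hg : Measurable g) (h0 : ∀ t, 0 < t → tailIntegral f t ≠ 0)
    (htop : ∀ t, 0 < t → tailIntegral f t ≠ ∞) :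
    ∫⁻ t in Ioi (0 : ℝ), f t * ∫⁻ s in Ioo 0 t, g s * tailIntegral f s ^ (-p) =
      ∫⁻ t in Ioi (0 : ℝ), g t * tailIntegral f t ^ (1 - p) := by
  have hV := measurable_tailIntegral f
  rw [← lintegral_tailIntegral_mul (by fun_prop) hf]
  refine setLIntegral_congr_fun measurableSet_Ioi fun t ht => ?_
  have h := ENNReal.rpow_add (-p) 1 (h0 t ht) (htop t ht)
  rw [ENNReal.rpow_one] at h
  rw [mul_assoc, ← h, neg_add_eq_sub]

/-- A density whose tail integral dominates the `p`-th power of the tail integral of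
`k ^ (1 / p) * f ^ (1 / q)`. -/
def dominatingDensity (p q : ℝ) (f k : ℝ → ℝ≥0∞) (t : ℝ) : ℝ≥0∞ :=
  k t * tailIntegral f t ^ ((p - 1) / q) * tailIntegral f t ^ (1 / q) +
    f t * tailIntegral f t ^ (-(1 / p)) *
      tailIntegral (fun s => k s * tailIntegral f s ^ ((p - 1) / q)) t

theorem measurable_dominatingDensity (p q : ℝ) {f k : ℝ → ℝ≥0∞} (hf : Measurable f)
    (hk : Measurable k) : Measurable (dominatingDensity p q f k) := by
  have hV := measurable_tailIntegral f
  have hF := measurable_tailIntegral fun s => k s * tailIntegral f s ^ ((p - 1) / q)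
  unfold dominatingDensity
  fun_prop

theorem tailIntegral_rpow_le_add {p q : ℝ} (hpq : p.HolderConjugate q) {f : ℝ → ℝ≥0∞}
    (hf : Measurable f) {x s : ℝ} (hxs : x < s) (h0 : ∀ t, x ≤ t → tailIntegral f t ≠ 0)
    (htop : ∀ t, x ≤ t → tailIntegral f t ≠ ∞) :
    tailIntegral f x ^ (1 / q) ≤
      tailIntegral f s ^ (1 / q) + ∫⁻ t in Ioo x s, f t * tailIntegral f t ^ (-(1 / p)) := by
  have hV := measurable_tailIntegral f
  have hsplit : tailIntegral f x = tailIntegral f s + ∫⁻ t in Ioo x s, f t := by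
    rw [setLIntegral_congr Ioo_ae_eq_Ioc, add_comm]
    unfold tailIntegral
    rw [← Ioc_union_Ioi_eq_Ioi hxs.le, lintegral_union measurableSet_Ioi (Ioc_disjoint_Ioi le_rfl)]
  have hpow : ∀ t, x ≤ t →
      tailIntegral f t ^ (1 / q) = tailIntegral f t * tailIntegral f t ^ (-(1 / p)) := by
    intro t ht
    have h := ENNReal.rpow_add 1 (-(1 / p)) (h0 t ht) (htop t ht)
    rw [ENNReal.rpow_one] at h
    rw [← h, one_div, one_div, ← sub_eq_add_neg, hpq.one_sub_inv]
  have hanti : ∀ t, x ≤ t →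
      tailIntegral f x ^ (-(1 / p)) ≤ tailIntegral f t ^ (-(1 / p)) := by
    intro t ht
    have := hpq.pos
    rw [ENNReal.rpow_neg, ENNReal.rpow_neg, ENNReal.inv_le_inv]
    exact ENNReal.rpow_le_rpow (tailIntegral_antitone f ht) (by positivity)
  rw [hpow x le_rfl, hpow s hxs.le]
  nth_rewrite 1 [hsplit]
  rw [add_mul, ← lintegral_mul_const _ hf]
  refine add_le_add (mul_le_mul_right (hanti s hxs.le) _) ?_
  refine setLIntegral_mono (by fun_prop) fun t ht => ?_
  exact mul_le_mul_right (hanti t ht.1.le) _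

theorem rpow_mul_tailIntegral_le {p q : ℝ} (hpq : p.HolderConjugate q) {f k : ℝ → ℝ≥0∞}
    (hf : Measurable f) (hk : Measurable k) {x : ℝ} (h0 : ∀ t, x ≤ t → tailIntegral f t ≠ 0)
    (htop : ∀ t, x ≤ t → tailIntegral f t ≠ ∞) :
    tailIntegral f x ^ (1 / q) * tailIntegral (fun s => k s * tailIntegral f s ^ ((p - 1) / q)) x ≤
      tailIntegral (dominatingDensity p q f k) x := by
  have hV := measurable_tailIntegral f
  have hm : Measurable fun t => f t * tailIntegral f t ^ (-(1 / p)) := by fun_prop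
  have hE : tailIntegral (dominatingDensity p q f k) x =
      ∫⁻ s in Ioi x, (k s * tailIntegral f s ^ ((p - 1) / q) * tailIntegral f s ^ (1 / q) +
        k s * tailIntegral f s ^ ((p - 1) / q) *
          ∫⁻ t in Ioo x s, f t * tailIntegral f t ^ (-(1 / p))) := by
    rw [lintegral_add_left (by fun_prop), ← lintegral_tailIntegral_mul hm (by fun_prop),
      ← lintegral_add_left (by fun_prop)]
    rfl
  rw [hE]
  unfold tailIntegral
  rw [← lintegral_const_mul _ (by change Measurable fun s => k s * tailIntegral f s ^ ((p - 1) / q)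
                                  fun_prop)]
  refine lintegral_mono_ae ((ae_restrict_iff' measurableSet_Ioi).2 (ae_of_all _ fun s hs => ?_))
  rw [← mul_add, mul_comm]
  gcongr
  exact tailIntegral_rpow_le_add hpq hf hs h0 htop

theorem tailIntegral_mul_rpow_le {p q : ℝ} (hpq : p.HolderConjugate q) {f k : ℝ → ℝ≥0∞}
    (hf : Measurable f) (hk : Measurable k) {x : ℝ} (h0 : ∀ t, x ≤ t → tailIntegral f t ≠ 0)
    (htop : ∀ t, x ≤ t → tailIntegral f t ≠ ∞) :
    tailIntegral (fun t => k t ^ (1 / p) * f t ^ (1 / q)) x ^ p ≤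
      ENNReal.ofReal p ^ (p - 1) * tailIntegral (dominatingDensity p q f k) x := by
  have hV := measurable_tailIntegral f
  have hp0 := hpq.pos
  have hq0 := hpq.symm.pos
  have hH := ENNReal.lintegral_mul_le_Lp_mul_Lq (volume.restrict (Ioi x)) hpq
    (f := fun s => (k s * tailIntegral f s ^ ((p - 1) / q)) ^ (1 / p))
    (g := fun s => (f s * tailIntegral f s ^ (-(1 / q))) ^ (1 / q)) (by fun_prop) (by fun_prop)
  simp only [← ENNReal.rpow_mul, one_div_mul_cancel hpq.ne_zero,
    one_div_mul_cancel hpq.symm.ne_zero, ENNReal.rpow_one] at hH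
  have hqlt : 1 / q < 1 := by rw [one_div]; exact inv_lt_one_of_one_lt₀ hpq.symm.lt
  have hA := setLIntegral_Ioi_mul_tailIntegral_rpow_neg_le hf h0 htop (θ := 1 / q)
    (by positivity) hqlt
  have h1q : 1 - 1 / q = 1 / p := by rw [one_div, one_div, hpq.symm.one_sub_inv]
  rw [h1q, one_div_one_div] at hA
  have hpq1 : p / q = p - 1 := hpq.div_conj_eq_sub_one
  have hL : tailIntegral (fun t => k t ^ (1 / p) * f t ^ (1 / q)) x =
      ∫⁻ s in Ioi x, ((fun s => (k s * tailIntegral f s ^ ((p - 1) / q)) ^ (1 / p)) *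
        (fun s => (f s * tailIntegral f s ^ (-(1 / q))) ^ (1 / q))) s := by
    refine setLIntegral_congr_fun measurableSet_Ioi fun s hs => ?_
    have hs' : x ≤ s := le_of_lt hs
    simp only [Pi.mul_apply]
    rw [ENNReal.mul_rpow_of_nonneg _ _ (by positivity),
      ENNReal.mul_rpow_of_nonneg _ _ (by positivity), mul_mul_mul_comm, ← ENNReal.rpow_mul,
      ← ENNReal.rpow_mul, ← ENNReal.rpow_add _ _ (h0 s hs') (htop s hs')]
    have : (p - 1) / q * (1 / p) + -(1 / q) * (1 / q) = 0 := by
      rw [← hpq1]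
      field_simp
      ring
    rw [this, ENNReal.rpow_zero, mul_one]
  rw [hL]
  calc _ ≤ ((∫⁻ s in Ioi x, k s * tailIntegral f s ^ ((p - 1) / q)) ^ (1 / p) *
        (ENNReal.ofReal p * tailIntegral f x ^ (1 / p)) ^ (1 / q)) ^ p := by
        gcongr
        exact hH.trans (by gcongr)
    _ = ENNReal.ofReal p ^ (p - 1) * (tailIntegral f x ^ (1 / q) *
          tailIntegral (fun s => k s * tailIntegral f s ^ ((p - 1) / q)) x) := by
        rw [ENNReal.mul_rpow_of_nonneg _ _ hp0.le, ← ENNReal.rpow_mul, ← ENNReal.rpow_mul,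
          one_div_mul_cancel hpq.ne_zero, ENNReal.rpow_one, one_div_mul_eq_div, hpq1,
          ENNReal.mul_rpow_of_nonneg _ _ hpq.sub_one_pos.le, ← ENNReal.rpow_mul,
          one_div_mul_eq_div, ← hpq1, div_right_comm p q p, div_self hpq.ne_zero, hpq1]
        simp only [tailIntegral]
        ring
    _ ≤ _ := by
        gcongr
        exact rpow_mul_tailIntegral_le hpq hf hk h0 htop

theorem lintegral_dominatingDensity_mul_le {p q : ℝ} (hpq : p.HolderConjugate q)
    {f k : ℝ → ℝ≥0∞} (hf : Measurable f) (hk : Measurable k)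
    (h0 : ∀ t, 0 < t → tailIntegral f t ≠ 0) (htop : ∀ t, 0 < t → tailIntegral f t ≠ ∞) :
    ∫⁻ t in Ioi (0 : ℝ), dominatingDensity p q f k t * tailIntegral f t ^ (1 - p) ≤
      (1 + ENNReal.ofReal ((1 + (p - 1) / q) / ((p - 1) / q))) * ∫⁻ t in Ioi (0 : ℝ), k t := by
  have hV := measurable_tailIntegral f
  set r := (p - 1) / q with hr
  have hr0 : 0 < r := div_pos hpq.sub_one_pos hpq.symm.pos
  have hrq : r + 1 / q = p - 1 := by
    have h1 := hpq.div_conj_eq_sub_one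
    rw [hr, ← add_div, sub_add_cancel, h1]
  have hpq' : 1 / p = 1 - 1 / q := by rw [one_div, one_div, hpq.symm.one_sub_inv]
  have hpt : ∀ t ∈ Ioi (0 : ℝ), dominatingDensity p q f k t * tailIntegral f t ^ (1 - p) =
      k t + f t * tailIntegral f t ^ (-(1 + r)) *
        tailIntegral (fun s => k s * tailIntegral f s ^ r) t := by
    intro t ht
    have hadd := fun a b => ENNReal.rpow_add a b (h0 t ht) (htop t ht)
    unfold dominatingDensity
    rw [add_mul, mul_assoc (k t), ← hadd, mul_assoc (k t), ← hadd, mul_right_comm (f t * _),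
      mul_assoc (f t), ← hadd, show r + 1 / q + (1 - p) = 0 by linarith, ENNReal.rpow_zero,
      mul_one, show -(1 / p) + (1 - p) = -(1 + r) by linarith]
  have hm : Measurable fun t => f t * tailIntegral f t ^ (-(1 + r)) := by fun_prop
  rw [setLIntegral_congr_fun measurableSet_Ioi hpt, lintegral_add_left hk,
    lintegral_tailIntegral_mul hm (by fun_prop), add_mul, one_mul,
    ← lintegral_const_mul _ hk]
  gcongr 1
  refine setLIntegral_mono (by fun_prop) fun s hs => ?_
  calc _ ≤ k s * tailIntegral f s ^ r *
        (ENNReal.ofReal ((1 + r) / r) * tailIntegral f s ^ (-r)) := by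
        gcongr
        exact setLIntegral_Ioo_mul_tailIntegral_rpow_neg_le hf h0 htop hs hr0
    _ = ENNReal.ofReal ((1 + r) / r) * k s *
        (tailIntegral f s ^ r * tailIntegral f s ^ (-r)) := by ring
    _ = _ := by
        rw [← ENNReal.rpow_add _ _ (h0 s hs) (htop s hs), add_neg_cancel, ENNReal.rpow_zero,
          mul_one]

theorem tailIntegral_ne_zero {f : ℝ → ℝ≥0∞} (hf : Measurable f) {x : ℝ}
    (hpos : ∀ᵐ t ∂volume.restrict (Ioi x), f t ≠ 0) : tailIntegral f x ≠ 0 := by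
  intro h
  have h0 := (lintegral_eq_zero_iff hf).1 h
  have hfalse : ∀ᵐ _ ∂volume.restrict (Ioi x), False := by
    filter_upwards [hpos, h0] with t h1 h2 using h1 h2
  rw [Filter.eventually_false_iff_eq_bot, ae_eq_bot, Measure.restrict_eq_zero,
    Real.volume_Ioi] at hfalse
  exact ENNReal.top_ne_zero hfalse

theorem Psi_rpow {p : ℝ} (hp : 1 < p) (v : ℝ → ℝ≥0∞) (t : ℝ) :
    Psi p v t ^ (1 - 2 * p) = tailIntegral (fun s => v s ^ (1 - p / (p - 1))) t ^ (1 - p) := by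
  have h1 : p - 1 ≠ 0 := by linarith
  have h2 : p + (p - 1) ≠ 0 := by linarith
  rw [Psi, ← ENNReal.rpow_mul, tailIntegral]
  congr 1
  field_simp
  ring

theorem wnorm_one (w f : ℝ → ℝ≥0∞) : wnorm 1 w f = ∫⁻ x in Ioi (0 : ℝ), f x * w x := by
  simp [wnorm]

theorem statement3 (p : ℝ) (hp : 1 < p)
    (T : (ℝ → ℝ≥0∞) → ℝ → ℝ≥0∞) (hT : IsMQL T)
    (w v : ℝ → ℝ≥0∞) (hw : IsWeight w) (hv : IsWeight v)
    (hvfin : ∀ x ∈ Ioi (0 : ℝ), (∫⁻ t in Ioi x, v t ^ (1 - p / (p - 1))) < ∞) :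
    (∃ C : ℝ≥0, 0 < C ∧ ∀ h : ℝ → ℝ≥0∞, Measurable h →
        essSup (fun x => T (fun y => ∫⁻ t in Ioi y, h t) x * w x) mu0 ≤
          (C : ℝ≥0∞) * wnorm p v h) ↔
      (∃ C' : ℝ≥0, 0 < C' ∧ ∀ h : ℝ → ℝ≥0∞, Measurable h →
        essSup (fun x =>
            T (fun y => (∫⁻ t in Ioi y, h t) ^ (1 / p)) x ^ p * w x ^ p) mu0 ≤
          (C' : ℝ≥0∞) * wnorm 1 (fun t => Psi p v t ^ (1 - 2 * p)) h) := by
  obtain ⟨C₁, hC₁, hmono⟩ := hT.mono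
  have hpq : p.HolderConjugate (p / (p - 1)) := Real.HolderConjugate.conjExponent hp
  set q := p / (p - 1) with hq
  have hp0 := hpq.pos
  have hvm := hv.1
  set σ : ℝ → ℝ≥0∞ := fun t => v t ^ (1 - q) with hσ
  have hσm : Measurable σ := by fun_prop
  have hσ0 : ∀ᵐ t ∂mu0, σ t ≠ 0 := by
    filter_upwards [hv.2] with t ht
    simp [hσ, ENNReal.rpow_eq_zero_iff, ht.1.ne', ht.2.ne]
  have hmu : ∀ x : ℝ, 0 < x → volume.restrict (Ioi x) ≤ mu0 := fun x hx =>
    Measure.restrict_mono (Ioi_subset_Ioi hx.le) le_rfl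
  have h0 : ∀ x, 0 < x → tailIntegral σ x ≠ 0 := fun x hx =>
    tailIntegral_ne_zero hσm (ae_mono (hmu x hx) hσ0)
  have htop : ∀ x, 0 < x → tailIntegral σ x ≠ ∞ := fun x hx => (hvfin x hx).ne
  simp only [Psi_rpow hp, wnorm_one]
  constructor
  · rintro ⟨C, hC, hbound⟩
    refine ⟨(C₁ * C) ^ p, NNReal.rpow_pos (mul_pos hC₁ hC), fun g hg => ?_⟩
    set N := ∫⁻ t in Ioi (0 : ℝ), g t * tailIntegral σ t ^ (1 - p) with hN
    by_cases hNtop : N = ∞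
    · rw [hNtop, ENNReal.mul_top (by exact_mod_cast (NNReal.rpow_pos (mul_pos hC₁ hC)).ne')]
      exact le_top
    set k : ℝ → ℝ≥0∞ := fun t => ∫⁻ s in Ioo 0 t, g s * tailIntegral σ s ^ (-p) with hk
    have hkm : Measurable k := measurable_lintegral_Ioo_left _ 0
    have hhm : Measurable fun t => σ t * k t ^ (1 / p) := by fun_prop
    have hnorm : wnorm p v (fun t => σ t * k t ^ (1 / p)) = N ^ (1 / p) := by
      rw [wnorm, hN, ← lintegral_mul_lintegral_Ioo_rpow_neg hσm hg h0 htop]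
      congr 1
      refine lintegral_congr_ae ?_
      filter_upwards [hv.2] with t ht
      rw [ENNReal.mul_rpow_of_nonneg _ _ hp0.le, ← ENNReal.rpow_mul (k t),
        one_div_mul_cancel hp0.ne', ENNReal.rpow_one, mul_right_comm]
      congr 1
      have h := ENNReal.rpow_add ((1 - q) * p) 1 ht.1.ne' ht.2.ne
      rw [ENNReal.rpow_one] at h
      rw [hσ, ← ENNReal.rpow_mul, ← h]
      congr 1
      linarith [hpq.mul_eq_add]
    have hle : ∀ᵐ y ∂mu0, (∫⁻ t in Ioi y, g t) ^ (1 / p) ≤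
        ∫⁻ t in Ioi y, σ t * k t ^ (1 / p) :=
      (ae_restrict_iff' measurableSet_Ioi).2 (ae_of_all _ fun y hy =>
        tailIntegral_rpow_one_div_le hpq hσm hg h0 htop hNtop hy)
    refine essSup_le_of_ae_le _ ?_
    filter_upwards [hmono _ _ ((measurable_tailIntegral g).pow_const (1 / p))
      (measurable_tailIntegral _) hle, ENNReal.ae_le_essSup (μ := mu0)
      (fun x => T (fun y => ∫⁻ t in Ioi y, σ t * k t ^ (1 / p)) x * w x)] with x hx1 hx2
    have hx3 := hx2.trans (hbound _ hhm)
    rw [hnorm] at hx3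
    calc _ = (T (fun y => (∫⁻ t in Ioi y, g t) ^ (1 / p)) x * w x) ^ p :=
          (ENNReal.mul_rpow_of_nonneg _ _ hp0.le).symm
      _ ≤ (C₁ * (C * N ^ (1 / p))) ^ p := by
          refine ENNReal.rpow_le_rpow ?_ hp0.le
          calc T (fun y => (∫⁻ t in Ioi y, g t) ^ (1 / p)) x * w x
              ≤ C₁ * T (fun y => ∫⁻ t in Ioi y, σ t * k t ^ (1 / p)) x * w x :=
                mul_le_mul_left hx1 (w x)
            _ ≤ _ := by
                rw [mul_assoc]
                exact mul_le_mul_right hx3 _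
      _ = _ := by
          rw [← mul_assoc, ENNReal.mul_rpow_of_nonneg _ _ hp0.le, ← ENNReal.rpow_mul,
            one_div_mul_cancel hp0.ne', ENNReal.rpow_one, ENNReal.coe_rpow_of_nonneg _ hp0.le,
            ENNReal.coe_mul]
  · rintro ⟨C', hC', hbound⟩
    set a : ℝ≥0 := p.toNNReal ^ ((p - 1) / p) with ha
    set b : ℝ≥0 := 1 + ((1 + (p - 1) / q) / ((p - 1) / q)).toNNReal with hb
    have ha0 : 0 < a := NNReal.rpow_pos (Real.toNNReal_pos.2 hp0)
    have hb0 : 0 < b := by positivity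
    refine ⟨C₁ * a * (C' * b) ^ (1 / p), mul_pos (mul_pos hC₁ ha0)
      (NNReal.rpow_pos (mul_pos hC' hb0)), fun h hh => ?_⟩
    set k : ℝ → ℝ≥0∞ := fun t => h t ^ p * v t with hk
    have hkm : Measurable k := by fun_prop
    set g := dominatingDensity p q σ k with hg
    have hgm : Measurable g := measurable_dominatingDensity p q hσm hkm
    have hk_eq : ∀ᵐ t ∂mu0, h t = k t ^ (1 / p) * σ t ^ (1 / q) := by
      filter_upwards [hv.2] with t ht
      rw [hk, hσ]
      simp only
      rw [ENNReal.mul_rpow_of_nonneg _ _ (by positivity), ← ENNReal.rpow_mul,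
        mul_one_div_cancel hp0.ne', ENNReal.rpow_one, mul_assoc, ← ENNReal.rpow_mul,
        ← ENNReal.rpow_add _ _ ht.1.ne' ht.2.ne]
      have : 1 / p + (1 - q) * (1 / q) = 0 := by
        rw [sub_mul, mul_one_div_cancel hpq.symm.ne_zero, one_mul]
        have := hpq.inv_add_inv_eq_one
        rw [one_div, one_div]
        linarith
      rw [this, ENNReal.rpow_zero, mul_one]
    have hle : ∀ᵐ y ∂mu0, (∫⁻ t in Ioi y, h t) ≤ a * (∫⁻ t in Ioi y, g t) ^ (1 / p) := by
      refine (ae_restrict_iff' measurableSet_Ioi).2 (ae_of_all _ fun y hy => ?_)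
      have hmain := tailIntegral_mul_rpow_le hpq hσm hkm (x := y)
        (fun t ht => h0 t (lt_of_lt_of_le hy ht)) (fun t ht => htop t (lt_of_lt_of_le hy ht))
      have hmain' := ENNReal.rpow_le_rpow hmain (one_div_nonneg.2 hp0.le)
      rw [← ENNReal.rpow_mul, mul_one_div_cancel hp0.ne', ENNReal.rpow_one,
        ENNReal.mul_rpow_of_nonneg _ _ (by positivity), ← ENNReal.rpow_mul, mul_one_div] at hmain'
      rw [lintegral_congr_ae (ae_mono (hmu y hy) hk_eq), ha, ENNReal.coe_rpow_of_nonneg _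
        (div_nonneg hpq.sub_one_pos.le hp0.le)]
      exact hmain'
    have hint : ∫⁻ t in Ioi (0 : ℝ), g t * tailIntegral σ t ^ (1 - p) ≤
        b * ∫⁻ t in Ioi (0 : ℝ), k t := by
      have := lintegral_dominatingDensity_mul_le hpq hσm hkm h0 htop
      rw [hb, ENNReal.coe_add, ENNReal.coe_one]
      exact this
    have hGm : Measurable fun y => (∫⁻ t in Ioi y, g t) ^ (1 / p) :=
      (measurable_tailIntegral g).pow_const _
    refine essSup_le_of_ae_le _ ?_
    filter_upwards [hmono _ _ (measurable_tailIntegral h) (hGm.const_mul (a : ℝ≥0∞)) hle,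
      ENNReal.ae_le_essSup (μ := mu0) (fun x =>
        T (fun y => (∫⁻ t in Ioi y, g t) ^ (1 / p)) x ^ p * w x ^ p)] with x hx1 hx2
    rw [hT.homog a _ hGm] at hx1
    have hx3 : T (fun y => (∫⁻ t in Ioi y, g t) ^ (1 / p)) x * w x ≤
        ((C' * b) ^ (1 / p) : ℝ≥0) * wnorm p v h := by
      have h1 := (hx2.trans (hbound g hgm)).trans (mul_le_mul_right hint (C' : ℝ≥0∞))
      rw [← ENNReal.mul_rpow_of_nonneg _ _ hp0.le, ← mul_assoc] at h1
      have h2 := ENNReal.rpow_le_rpow h1 (one_div_nonneg.2 hp0.le)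
      rw [← ENNReal.rpow_mul, mul_one_div_cancel hp0.ne', ENNReal.rpow_one,
        ENNReal.mul_rpow_of_nonneg _ _ (by positivity)] at h2
      rw [ENNReal.coe_rpow_of_nonneg _ (by positivity), ENNReal.coe_mul]
      exact h2
    calc _ ≤ C₁ * (a * T (fun y => (∫⁻ t in Ioi y, g t) ^ (1 / p)) x) * w x := by
          gcongr
          exact hx1
      _ = C₁ * a * (T (fun y => (∫⁻ t in Ioi y, g t) ^ (1 / p)) x * w x) := by ring
      _ ≤ C₁ * a * (((C' * b) ^ (1 / p) : ℝ≥0) * wnorm p v h) := by gcongr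
      _ = _ := by
          push_cast
          ring
end
end
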